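/- arXiv:1603.03259 — 12 statements merged into one kernel-verified Lean document; each statement's English description precedes it below -/
import Mathlib

section
/- Let A be the 2×2 matrix over D with rows (y₁, x₂) and (x₁, y₂), and let B be the 2×2 matrix over D with rows (ȳ₁, x̄₂) and (x̄₁, ȳ₂). Then A·B = 1 and B·A = 1, i.e. A is invertible in the ring of 2×2 matrices over D with inverse B. -/
/-- The matrix of inverse quasideterminants is a left inverse of a `2 × 2` matrix with nonzero
entries over a division ring. -/
theorem quasideterminant_inverse_mul {D : Type*} [DivisionRing D] {a b c d : D}
    (ha : a ≠ 0) (hb : b ≠ 0) (hc : c ≠ 0) (hd : d ≠ 0) (hP : a - b * d⁻¹ * c ≠ 0) :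
    (!![(a - b * d⁻¹ * c)⁻¹, (c - d * b⁻¹ * a)⁻¹;
        (b - a * c⁻¹ * d)⁻¹, (d - c * a⁻¹ * b)⁻¹] : Matrix (Fin 2) (Fin 2) D) *
      !![a, b; c, d] = 1 := by
  set P := a - b * d⁻¹ * c with hPdef
  have e₁ : (c - d * b⁻¹ * a)⁻¹ = -(P⁻¹ * (b * d⁻¹)) := by
    have h : c - d * b⁻¹ * a = -(d * b⁻¹ * P) := by
      simp [hPdef, mul_sub, mul_assoc, hb, hd]
    rw [h, inv_neg]
    simp [mul_assoc]
  have e₂ : (b - a * c⁻¹ * d)⁻¹ = -(d⁻¹ * c * P⁻¹) := by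
    have h : b - a * c⁻¹ * d = -(P * (c⁻¹ * d)) := by
      simp [hPdef, sub_mul, mul_assoc, hc, hd]
    rw [h, inv_neg]
    simp [mul_assoc]
  have e₃ : (d - c * a⁻¹ * b)⁻¹ = d⁻¹ * c * P⁻¹ * a * c⁻¹ := by
    have h : d - c * a⁻¹ * b = c * a⁻¹ * P * (c⁻¹ * d) := by
      simp [hPdef, sub_mul, mul_sub, mul_assoc, ha, hc, hd]
    rw [h]
    simp [mul_assoc]
  have h₁₁ : P⁻¹ * a - P⁻¹ * (b * d⁻¹) * c = 1 := by
    rw [mul_assoc P⁻¹, ← mul_sub, ← hPdef, inv_mul_cancel₀ hP]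
  have h₂₂ : d⁻¹ * c * P⁻¹ * a * c⁻¹ * d - d⁻¹ * c * P⁻¹ * b = 1 := by
    have h : d⁻¹ * c * P⁻¹ * a * c⁻¹ * d - d⁻¹ * c * P⁻¹ * b
        = d⁻¹ * c * (P⁻¹ * a - P⁻¹ * (b * d⁻¹) * c) * (c⁻¹ * d) := by
      simp [sub_mul, mul_sub, mul_assoc, hc, hd]
    rw [h, h₁₁]
    simp [mul_assoc, hc, hd]
  rw [e₁, e₂, e₃, Matrix.mul_fin_two, Matrix.one_fin_two]
  congr 1
  simp only [neg_mul, ← sub_eq_add_neg, neg_add_eq_sub, h₁₁, h₂₂]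
  simp [mul_assoc, hc, hd]


/-- The matrix `A = !![y₁, x₂; x₁, y₂]` over a division ring `D`, with entries
satisfying ultralocality and Weyl commutation relations, is invertible with inverse
`B = !![ȳ₁, x̄₂; x̄₁, ȳ₂]`. -/
theorem matrix_A_inverse {D : Type*} [DivisionRing D]
    (x₁ y₁ x₂ y₂ : D)
    (hx₁ : x₁ ≠ 0) (hy₁ : y₁ ≠ 0) (hx₂ : x₂ ≠ 0) (hy₂ : y₂ ≠ 0)
    (hxx : x₁ * x₂ = x₂ * x₁) (hyy : y₁ * y₂ = y₂ * y₁)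
    (hxy : x₁ * y₂ = y₂ * x₁) (hyx : y₁ * x₂ = x₂ * y₁)
    (h1 : y₁ - x₂ * y₂⁻¹ * x₁ ≠ 0) (h2 : x₁ - y₂ * x₂⁻¹ * y₁ ≠ 0)
    (h3 : x₂ - y₁ * x₁⁻¹ * y₂ ≠ 0) (h4 : y₂ - x₁ * y₁⁻¹ * x₂ ≠ 0)
    (q : D) (hq : q ≠ 0) (hqcentral : ∀ d : D, q * d = d * q)
    (hw1 : y₁ * x₁ = q * (x₁ * y₁)) (hw2 : y₂ * x₂ = q * (x₂ * y₂)) :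
    (!![y₁, x₂; x₁, y₂] : Matrix (Fin 2) (Fin 2) D) *
      !![(y₁ - x₂ * y₂⁻¹ * x₁)⁻¹, (x₁ - y₂ * x₂⁻¹ * y₁)⁻¹;
         (x₂ - y₁ * x₁⁻¹ * y₂)⁻¹, (y₂ - x₁ * y₁⁻¹ * x₂)⁻¹] = 1 ∧
    (!![(y₁ - x₂ * y₂⁻¹ * x₁)⁻¹, (x₁ - y₂ * x₂⁻¹ * y₁)⁻¹;
        (x₂ - y₁ * x₁⁻¹ * y₂)⁻¹, (y₂ - x₁ * y₁⁻¹ * x₂)⁻¹] : Matrix (Fin 2) (Fin 2) D) *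
      !![y₁, x₂; x₁, y₂] = 1 := by
  have key := quasideterminant_inverse_mul hy₁ hx₂ hx₁ hy₂ h1
  exact ⟨mul_eq_one_comm.mp key, key⟩
end

section
/- The elements x̄₁, ȳ₁, x̄₂, ȳ₂ satisfy the ultralocality relations x̄₁x̄₂ = x̄₂x̄₁, ȳ₁ȳ₂ = ȳ₂ȳ₁, x̄₁ȳ₂ = ȳ₂x̄₁, and ȳ₁x̄₂ = x̄₂ȳ₁. -/
/-- The inverse-matrix entries satisfy the same ultralocality relations. -/
theorem inverse_entries_ultralocality {D : Type*} [DivisionRing D]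
    (x₁ y₁ x₂ y₂ : D)
    (hx₁ : x₁ ≠ 0) (hy₁ : y₁ ≠ 0) (hx₂ : x₂ ≠ 0) (hy₂ : y₂ ≠ 0)
    (hxx : x₁ * x₂ = x₂ * x₁) (hyy : y₁ * y₂ = y₂ * y₁)
    (hxy : x₁ * y₂ = y₂ * x₁) (hyx : y₁ * x₂ = x₂ * y₁)
    (h1 : y₁ - x₂ * y₂⁻¹ * x₁ ≠ 0) (h2 : x₁ - y₂ * x₂⁻¹ * y₁ ≠ 0)
    (h3 : x₂ - y₁ * x₁⁻¹ * y₂ ≠ 0) (h4 : y₂ - x₁ * y₁⁻¹ * x₂ ≠ 0)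
    (yb₁ xb₂ xb₁ yb₂ : D)
    (hyb₁ : yb₁ = (y₁ - x₂ * y₂⁻¹ * x₁)⁻¹) (hxb₂ : xb₂ = (x₁ - y₂ * x₂⁻¹ * y₁)⁻¹)
    (hxb₁ : xb₁ = (x₂ - y₁ * x₁⁻¹ * y₂)⁻¹) (hyb₂ : yb₂ = (y₂ - x₁ * y₁⁻¹ * x₂)⁻¹)
    (q : D) (hq : q ≠ 0) (hqcentral : ∀ d : D, q * d = d * q)
    (hw1 : y₁ * x₁ = q * (x₁ * y₁)) (hw2 : y₂ * x₂ = q * (x₂ * y₂)) :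
    xb₁ * xb₂ = xb₂ * xb₁ ∧ yb₁ * yb₂ = yb₂ * yb₁ ∧
    xb₁ * yb₂ = yb₂ * xb₁ ∧ yb₁ * xb₂ = xb₂ * yb₁ := by
  subst hyb₁ hxb₂ hxb₁ hyb₂
  obtain ⟨u, hu⟩ : ∃ u, u = x₂ * y₂⁻¹ := ⟨_, rfl⟩
  obtain ⟨v, hv⟩ : ∃ v, v = y₁ * x₁⁻¹ := ⟨_, rfl⟩
  have hu0 : u ≠ 0 := hu ▸ mul_ne_zero hx₂ (inv_ne_zero hy₂)
  have hv0 : v ≠ 0 := hv ▸ mul_ne_zero hy₁ (inv_ne_zero hx₁)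
  have hui : u⁻¹ = y₂ * x₂⁻¹ := by rw [hu, mul_inv_rev, inv_inv]
  have hvi : v⁻¹ = x₁ * y₁⁻¹ := by rw [hv, mul_inv_rev, inv_inv]
  have hux : u * y₂ = x₂ := by rw [hu, inv_mul_cancel_right₀ hy₂]
  have hvy : v * x₁ = y₁ := by rw [hv, inv_mul_cancel_right₀ hx₁]
  have cux₁ : Commute u x₁ := by
    rw [hu]; exact (Commute.mul_right hxx (Commute.inv_right₀ hxy)).symm
  have cuy₁ : Commute u y₁ := by
    rw [hu]; exact (Commute.mul_right hyx (Commute.inv_right₀ hyy)).symm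
  have cvy₂ : Commute v y₂ := by
    rw [hv]; exact Commute.mul_left hyy (Commute.inv_left₀ hxy)
  have cuv : Commute u v := by
    rw [hv]; exact cuy₁.mul_right cux₁.inv_right₀
  have cuw : Commute u (v - u) := cuv.sub_right (Commute.refl u)
  have cvw : Commute v (v - u) := (Commute.refl v).sub_right cuv.symm
  have hA : y₁ - x₂ * y₂⁻¹ * x₁ = (v - u) * x₁ := by rw [← hu, sub_mul, hvy]
  have hB : x₁ - y₂ * x₂⁻¹ * y₁ = -(u⁻¹ * ((v - u) * x₁)) := by
    rw [← hui, sub_mul, hvy, mul_sub, inv_mul_cancel_left₀ hu0, neg_sub]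
  have hC : x₂ - y₁ * x₁⁻¹ * y₂ = -((v - u) * y₂) := by
    rw [← hv, sub_mul, hux, neg_sub]
  have hE : y₂ - x₁ * y₁⁻¹ * x₂ = v⁻¹ * ((v - u) * y₂) := by
    rw [← hvi, sub_mul, hux, mul_sub, inv_mul_cancel_left₀ hv0]
  have exchange : y₂ * (v - u) * x₁ = q * (x₁ * (v - u) * y₂) := by
    have e1 : y₂ * (v - u) * x₁ = y₁ * y₂ - q * (x₁ * x₂) := by
      have : y₂ * u = q * x₂ := by
        rw [hu, ← mul_assoc, hw2, mul_assoc, mul_inv_cancel_right₀ hy₂]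
      rw [mul_sub, sub_mul, mul_assoc, hvy, this, mul_assoc, hyy, hxx]
    have e2 : q * (x₁ * (v - u) * y₂) = y₁ * y₂ - q * (x₁ * x₂) := by
      have : q * (x₁ * v) = y₁ := by
        rw [hv, ← mul_assoc, ← mul_assoc, mul_assoc q, ← hw1, mul_inv_cancel_right₀ hx₁]
      rw [mul_sub, sub_mul, mul_sub, ← mul_assoc q, this, mul_assoc x₁, hux]
    rw [e1, e2]
  have hxv : x₁ * v⁻¹ = q * (v⁻¹ * x₁) := by
    have h : q * (x₁ * v) = v * x₁ := by
      rw [hvy, hv, ← mul_assoc, ← mul_assoc, mul_assoc q, ← hw1, mul_inv_cancel_right₀ hx₁]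
    apply mul_right_cancel₀ hv0
    rw [inv_mul_cancel_right₀ hv0, mul_assoc, mul_assoc,
      (show Commute q v⁻¹ from hqcentral _).left_comm, h, inv_mul_cancel_left₀ hv0]
  have hyu : q * (y₂ * u⁻¹) = u⁻¹ * y₂ := by
    have h : y₂ * u = q * (u * y₂) := by
      rw [hux, hu, ← mul_assoc, hw2, mul_assoc, mul_inv_cancel_right₀ hy₂]
    apply mul_right_cancel₀ hu0
    rw [mul_assoc, inv_mul_cancel_right₀ hu0, mul_assoc, h,
      ← (show Commute q u⁻¹ from hqcentral _).left_comm, inv_mul_cancel_left₀ hu0]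
  rw [hA, hB, hC, hE]
  refine ⟨Commute.inv_left₀ (Commute.inv_right₀ ?_), Commute.inv_left₀ (Commute.inv_right₀ ?_),
    Commute.inv_left₀ (Commute.inv_right₀ ?_), Commute.inv_left₀ (Commute.inv_right₀ ?_)⟩
  · refine Commute.neg_left (Commute.neg_right ?_)
    apply mul_left_cancel₀ hq
    calc q * ((v - u) * y₂ * (u⁻¹ * ((v - u) * x₁)))
        = q * (v - u) * (y₂ * u⁻¹) * ((v - u) * x₁) := by simp only [mul_assoc]
      _ = (v - u) * (q * (y₂ * u⁻¹)) * ((v - u) * x₁) := by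
        rw [hqcentral (v - u), mul_assoc (v - u) q]
      _ = (v - u) * u⁻¹ * (y₂ * (v - u) * x₁) := by
        rw [hyu]; simp only [mul_assoc]
      _ = u⁻¹ * (v - u) * q * (x₁ * (v - u) * y₂) := by
        rw [exchange, cuw.symm.inv_right₀.eq, mul_assoc _ q]
      _ = q * (u⁻¹ * ((v - u) * x₁) * ((v - u) * y₂)) := by
        rw [← hqcentral]; simp only [mul_assoc]
  · calc (v - u) * x₁ * (v⁻¹ * ((v - u) * y₂))
        = (v - u) * (x₁ * v⁻¹) * ((v - u) * y₂) := by simp only [mul_assoc]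
      _ = q * ((v - u) * v⁻¹ * (x₁ * (v - u) * y₂)) := by
        rw [hxv, ← (show Commute q (v - u) from hqcentral _).left_comm]; simp only [mul_assoc]
      _ = v⁻¹ * (v - u) * (q * (x₁ * (v - u) * y₂)) := by
        rw [cvw.symm.inv_right₀.eq, ← mul_assoc, hqcentral, mul_assoc]
      _ = v⁻¹ * ((v - u) * y₂) * ((v - u) * x₁) := by
        rw [← exchange]; simp only [mul_assoc]
  · exact ((cvw.mul_right cvy₂).inv_left₀.symm.mul_right (Commute.refl _)).neg_left
  · exact ((cuw.mul_right cux₁).inv_left₀.symm.mul_right (Commute.refl _)).neg_right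
end

section
/- The pairs (x̄₁, ȳ₁) and (x̄₂, ȳ₂) satisfy the Weyl commutation relations with q⁻¹ in place of q: ȳ₁x̄₁ = q⁻¹·x̄₁ȳ₁ and ȳ₂x̄₂ = q⁻¹·x̄₂ȳ₂. -/
/-- For two commuting Weyl pairs, the elements `y₁ - x₂ * y₂⁻¹ * x₁` and `x₂ - y₁ * x₁⁻¹ * y₂`
`q`-commute. -/
theorem weyl_relation_schur_complements {D : Type*} [DivisionRing D]
    {x₁ y₁ x₂ y₂ q : D} (hx₁ : x₁ ≠ 0) (hy₂ : y₂ ≠ 0)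
    (hxx : Commute x₁ x₂) (hyy : Commute y₁ y₂) (hxy : Commute x₁ y₂)
    (hq : ∀ d : D, Commute q d)
    (hw1 : y₁ * x₁ = q * (x₁ * y₁)) (hw2 : y₂ * x₂ = q * (x₂ * y₂)) :
    (x₂ - y₁ * x₁⁻¹ * y₂) * (y₁ - x₂ * y₂⁻¹ * x₁) =
      q * ((y₁ - x₂ * y₂⁻¹ * x₁) * (x₂ - y₁ * x₁⁻¹ * y₂)) := by
  set u := x₂ * y₂⁻¹ with hu
  set v := y₁ * x₁⁻¹ with hv
  have hx₂ : x₂ = u * y₂ := by rw [hu, inv_mul_cancel_right₀ hy₂]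
  have hy₁ : y₁ = v * x₁ := by rw [hv, inv_mul_cancel_right₀ hx₁]
  have hux : x₁ * u = u * x₁ := hxx.mul_right hxy.inv_right₀
  have hvy : y₂ * v = v * y₂ := hyy.symm.mul_right hxy.symm.inv_right₀
  have hvx : q * (x₁ * v) = v * x₁ := by
    rw [hv, ← mul_assoc x₁, ← mul_assoc q, ← hw1, mul_inv_cancel_right₀ hx₁,
      inv_mul_cancel_right₀ hx₁]
  have huy : y₂ * u = q * (u * y₂) := by
    rw [hu, ← mul_assoc y₂, hw2, ← mul_assoc q, mul_inv_cancel_right₀ hy₂,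
      inv_mul_cancel_right₀ hy₂]
  have hB : x₂ - v * y₂ = (u - v) * y₂ := by rw [sub_mul, ← hx₂]
  have hA : y₁ - u * x₁ = (v - u) * x₁ := by rw [sub_mul, ← hy₁]
  have hmid : y₂ * (v - u) * x₁ = q * (x₁ * (v - u) * y₂) := by
    have h₁ : y₂ * v * x₁ = q * (x₁ * v * y₂) := by
      rw [← mul_assoc q, hvx, hvy, mul_assoc v, mul_assoc v, hxy.eq]
    have h₂ : y₂ * u * x₁ = q * (x₁ * u * y₂) := by
      rw [huy, hux, mul_assoc q, mul_assoc u, mul_assoc u, hxy.eq]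
    simp only [mul_sub, sub_mul, h₁, h₂]
  calc (x₂ - v * y₂) * (y₁ - u * x₁)
      = (u - v) * (y₂ * (v - u) * x₁) := by rw [hA, hB]; simp only [mul_assoc]
    _ = q * ((u - v) * (x₁ * (v - u) * y₂)) := by
      rw [hmid, ← mul_assoc, ← (hq _).eq, mul_assoc]
    _ = q * ((y₁ - u * x₁) * (x₂ - v * y₂)) := by
      rw [hA, hB]; noncomm_ring

/-- Inverting a `q`-commuting pair in a division ring replaces `q` by `q⁻¹`. -/
theorem inv_mul_inv_eq_of_weyl_relation {D : Type*} [DivisionRing D] {a b q : D}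
    (hq : ∀ d : D, Commute q d) (h : b * a = q * (a * b)) :
    a⁻¹ * b⁻¹ = q⁻¹ * (b⁻¹ * a⁻¹) := by
  rw [← mul_inv_rev, h, (hq _).eq, mul_inv_rev, mul_inv_rev]


/-- The inverse-matrix entries satisfy the Weyl commutation relations with q⁻¹. -/
theorem inverse_entries_weyl {D : Type*} [DivisionRing D]
    (x₁ y₁ x₂ y₂ : D)
    (hx₁ : x₁ ≠ 0) (hy₁ : y₁ ≠ 0) (hx₂ : x₂ ≠ 0) (hy₂ : y₂ ≠ 0)
    (hxx : x₁ * x₂ = x₂ * x₁) (hyy : y₁ * y₂ = y₂ * y₁)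
    (hxy : x₁ * y₂ = y₂ * x₁) (hyx : y₁ * x₂ = x₂ * y₁)
    (h1 : y₁ - x₂ * y₂⁻¹ * x₁ ≠ 0) (h2 : x₁ - y₂ * x₂⁻¹ * y₁ ≠ 0)
    (h3 : x₂ - y₁ * x₁⁻¹ * y₂ ≠ 0) (h4 : y₂ - x₁ * y₁⁻¹ * x₂ ≠ 0)
    (yb₁ xb₂ xb₁ yb₂ : D)
    (hyb₁ : yb₁ = (y₁ - x₂ * y₂⁻¹ * x₁)⁻¹) (hxb₂ : xb₂ = (x₁ - y₂ * x₂⁻¹ * y₁)⁻¹)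
    (hxb₁ : xb₁ = (x₂ - y₁ * x₁⁻¹ * y₂)⁻¹) (hyb₂ : yb₂ = (y₂ - x₁ * y₁⁻¹ * x₂)⁻¹)
    (q : D) (hq : q ≠ 0) (hqcentral : ∀ d : D, q * d = d * q)
    (hw1 : y₁ * x₁ = q * (x₁ * y₁)) (hw2 : y₂ * x₂ = q * (x₂ * y₂)) :
    yb₁ * xb₁ = q⁻¹ * (xb₁ * yb₁) ∧ yb₂ * xb₂ = q⁻¹ * (xb₂ * yb₂) := by
  subst hyb₁ hxb₂ hxb₁ hyb₂
  exact ⟨inv_mul_inv_eq_of_weyl_relation hqcentral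
      (weyl_relation_schur_complements hx₁ hy₂ hxx hyy hxy hqcentral hw1 hw2),
    inv_mul_inv_eq_of_weyl_relation hqcentral
      (weyl_relation_schur_complements hx₂ hy₁ hxx.symm hyy.symm hyx.symm hqcentral hw2 hw1)⟩
end

section
/- Without assuming any Weyl commutation relations (only the ultralocality relations), the elements x̄₁ and ȳ₂ commute and the elements ȳ₁ and x̄₂ commute: x̄₁ȳ₂ = ȳ₂x̄₁ and ȳ₁x̄₂ = x̄₂ȳ₁. -/
/-- If a nonzero `t` commutes with `c` and `d`, then `c - t * d` and `d - t⁻¹ * c`, which differ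
by the left factor `-t⁻¹`, commute. -/
theorem Commute.sub_mul_sub_inv_mul {D : Type*} [DivisionRing D] {t c d : D} (ht : t ≠ 0)
    (hc : Commute t c) (hd : Commute t d) : Commute (c - t * d) (d - t⁻¹ * c) := by
  have hB : d - t⁻¹ * c = -(t⁻¹ * (c - t * d)) := by
    rw [mul_sub, inv_mul_cancel_left₀ ht, neg_sub]
  have hA : Commute t (c - t * d) := hc.sub_right ((Commute.refl t).mul_right hd)
  rw [hB]
  exact (hA.symm.inv_right₀.mul_right (Commute.refl _)).neg_right

/-- Under ultralocality alone (no Weyl relations), xb₁ commutes with yb₂ and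
yb₁ commutes with xb₂. -/
theorem inverse_entries_partial_commutativity {D : Type*} [DivisionRing D]
    (x₁ y₁ x₂ y₂ : D)
    (hx₁ : x₁ ≠ 0) (hy₁ : y₁ ≠ 0) (hx₂ : x₂ ≠ 0) (hy₂ : y₂ ≠ 0)
    (hxx : x₁ * x₂ = x₂ * x₁) (hyy : y₁ * y₂ = y₂ * y₁)
    (hxy : x₁ * y₂ = y₂ * x₁) (hyx : y₁ * x₂ = x₂ * y₁)
    (h1 : y₁ - x₂ * y₂⁻¹ * x₁ ≠ 0) (h2 : x₁ - y₂ * x₂⁻¹ * y₁ ≠ 0)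
    (h3 : x₂ - y₁ * x₁⁻¹ * y₂ ≠ 0) (h4 : y₂ - x₁ * y₁⁻¹ * x₂ ≠ 0)
    (yb₁ xb₂ xb₁ yb₂ : D)
    (hyb₁ : yb₁ = (y₁ - x₂ * y₂⁻¹ * x₁)⁻¹) (hxb₂ : xb₂ = (x₁ - y₂ * x₂⁻¹ * y₁)⁻¹)
    (hxb₁ : xb₁ = (x₂ - y₁ * x₁⁻¹ * y₂)⁻¹) (hyb₂ : yb₂ = (y₂ - x₁ * y₁⁻¹ * x₂)⁻¹) :
    xb₁ * yb₂ = yb₂ * xb₁ ∧ yb₁ * xb₂ = xb₂ * yb₁ := by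
  have hac : Commute x₁ x₂ := hxx
  have hbd : Commute y₁ y₂ := hyy
  have had : Commute x₁ y₂ := hxy
  have hbc : Commute y₁ x₂ := hyx
  subst hyb₁ hxb₂ hxb₁ hyb₂
  constructor
  · have h := Commute.sub_mul_sub_inv_mul (mul_ne_zero hy₁ (inv_ne_zero hx₁))
      (hbc.mul_left hac.inv_left₀) (hbd.mul_left had.inv_left₀)
    rw [mul_inv_rev, inv_inv] at h
    exact (Commute.inv_left₀ h).inv_right₀
  · have h := Commute.sub_mul_sub_inv_mul (mul_ne_zero hx₂ (inv_ne_zero hy₂))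
      (hbc.symm.mul_left hbd.symm.inv_left₀) (hac.symm.mul_left had.symm.inv_left₀)
    rw [mul_inv_rev, inv_inv] at h
    exact (Commute.inv_left₀ h).inv_right₀
end

section
/- Under the ultralocality relations alone, the following identity holds in D: (x̄₁x̄₂)⁻¹ − (x̄₂x̄₁)⁻¹ = (y₂ − x₁y₁⁻¹x₂) · y₁ · (y₁x₁⁻¹x₂⁻¹y₂ − x₁⁻¹y₁y₂x₂⁻¹). -/
/-- The key identity for (xb₁xb₂)⁻¹ − (xb₂xb₁)⁻¹ under ultralocality alone. -/
theorem bar_xx_identity {D : Type*} [DivisionRing D]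
    (x₁ y₁ x₂ y₂ : D)
    (hx₁ : x₁ ≠ 0) (hy₁ : y₁ ≠ 0) (hx₂ : x₂ ≠ 0) (hy₂ : y₂ ≠ 0)
    (hxx : x₁ * x₂ = x₂ * x₁) (hyy : y₁ * y₂ = y₂ * y₁)
    (hxy : x₁ * y₂ = y₂ * x₁) (hyx : y₁ * x₂ = x₂ * y₁)
    (h1 : y₁ - x₂ * y₂⁻¹ * x₁ ≠ 0) (h2 : x₁ - y₂ * x₂⁻¹ * y₁ ≠ 0)
    (h3 : x₂ - y₁ * x₁⁻¹ * y₂ ≠ 0) (h4 : y₂ - x₁ * y₁⁻¹ * x₂ ≠ 0)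
    (yb₁ xb₂ xb₁ yb₂ : D)
    (hyb₁ : yb₁ = (y₁ - x₂ * y₂⁻¹ * x₁)⁻¹) (hxb₂ : xb₂ = (x₁ - y₂ * x₂⁻¹ * y₁)⁻¹)
    (hxb₁ : xb₁ = (x₂ - y₁ * x₁⁻¹ * y₂)⁻¹) (hyb₂ : yb₂ = (y₂ - x₁ * y₁⁻¹ * x₂)⁻¹) :
    (xb₁ * xb₂)⁻¹ - (xb₂ * xb₁)⁻¹ =
      (y₂ - x₁ * y₁⁻¹ * x₂) * y₁ *
        (y₁ * x₁⁻¹ * x₂⁻¹ * y₂ - x₁⁻¹ * y₁ * y₂ * x₂⁻¹) := by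
  have cxx : Commute x₂ x₁ := hxx.symm
  have cyy : Commute y₂ y₁ := hyy.symm
  have cyx : Commute y₂ x₁ := hxy.symm
  have cxy : Commute x₂ y₁ := hyx.symm
  rw [hxb₁, hxb₂, mul_inv_rev, mul_inv_rev, inv_inv, inv_inv]
  -- Move every factor from `x₂, y₂` to the right of every factor from `x₁, y₁`.
  simp only [mul_sub, sub_mul, mul_assoc,
    cxx.eq, cyy.eq, cyx.eq, cxy.eq, cyy.left_comm, cxy.left_comm,
    cxy.inv_left₀.eq, cxy.inv_left₀.left_comm,
    cxx.inv_right₀.left_comm, cyx.inv_right₀.left_comm,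
    cxx.inv_left₀.inv_right₀.left_comm,
    inv_mul_cancel₀ hx₂, mul_inv_cancel_left₀ hx₂,
    mul_inv_cancel_left₀ hx₁, inv_mul_cancel_left₀ hx₁, inv_mul_cancel_left₀ hy₁, mul_one]
  abel
end

section
/- Under the ultralocality relations alone, the following identity holds in D: (ȳ₁ȳ₂)⁻¹ − (ȳ₂ȳ₁)⁻¹ = (y₁ − x₂y₂⁻¹x₁) · y₂ · (x₁y₁⁻¹y₂⁻¹x₂ − y₁⁻¹x₁x₂y₂⁻¹). -/
/-- The key identity for (yb₁yb₂)⁻¹ − (yb₂yb₁)⁻¹ under ultralocality alone. -/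
theorem bar_yy_identity {D : Type*} [DivisionRing D]
    (x₁ y₁ x₂ y₂ : D)
    (hx₁ : x₁ ≠ 0) (hy₁ : y₁ ≠ 0) (hx₂ : x₂ ≠ 0) (hy₂ : y₂ ≠ 0)
    (hxx : x₁ * x₂ = x₂ * x₁) (hyy : y₁ * y₂ = y₂ * y₁)
    (hxy : x₁ * y₂ = y₂ * x₁) (hyx : y₁ * x₂ = x₂ * y₁)
    (h1 : y₁ - x₂ * y₂⁻¹ * x₁ ≠ 0) (h2 : x₁ - y₂ * x₂⁻¹ * y₁ ≠ 0)
    (h3 : x₂ - y₁ * x₁⁻¹ * y₂ ≠ 0) (h4 : y₂ - x₁ * y₁⁻¹ * x₂ ≠ 0)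
    (yb₁ xb₂ xb₁ yb₂ : D)
    (hyb₁ : yb₁ = (y₁ - x₂ * y₂⁻¹ * x₁)⁻¹) (hxb₂ : xb₂ = (x₁ - y₂ * x₂⁻¹ * y₁)⁻¹)
    (hxb₁ : xb₁ = (x₂ - y₁ * x₁⁻¹ * y₂)⁻¹) (hyb₂ : yb₂ = (y₂ - x₁ * y₁⁻¹ * x₂)⁻¹) :
    (yb₁ * yb₂)⁻¹ - (yb₂ * yb₁)⁻¹ =
      (y₁ - x₂ * y₂⁻¹ * x₁) * y₂ *
        (x₁ * y₁⁻¹ * y₂⁻¹ * x₂ - y₁⁻¹ * x₁ * x₂ * y₂⁻¹) := by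
  subst hyb₁ hyb₂
  have cxx : Commute x₁ x₂ := hxx
  have cyy : Commute y₁ y₂ := hyy
  have cxy : Commute x₁ y₂⁻¹ := Commute.inv_right₀ hxy
  have cyx : Commute y₁⁻¹ x₂ := Commute.inv_left₀ hyx
  have cyy' : Commute y₁⁻¹ y₂⁻¹ := Commute.inv_left₀ (Commute.inv_right₀ hyy)
  obtain ⟨P, hP⟩ : ∃ P, P = y₁ * y₂ - x₁ * x₂ := ⟨_, rfl⟩
  have hA : y₁ - x₂ * y₂⁻¹ * x₁ = P * y₂⁻¹ := by
    rw [hP, sub_mul, mul_inv_cancel_right₀ hy₂, mul_assoc x₂, ← cxy.eq, ← mul_assoc, cxx.eq]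
  have hB : y₂ - x₁ * y₁⁻¹ * x₂ = P * y₁⁻¹ := by
    rw [hP, sub_mul, cyy.eq, mul_inv_cancel_right₀ hy₁, mul_assoc x₁, cyx.eq, ← mul_assoc]
  have hBA : y₁⁻¹ * P * y₂⁻¹ = 1 - y₁⁻¹ * x₁ * x₂ * y₂⁻¹ := by
    rw [hP, mul_sub, sub_mul, inv_mul_cancel_left₀ hy₁, mul_inv_cancel₀ hy₂]
    simp only [mul_assoc]
  have hAB : y₂⁻¹ * P * y₁⁻¹ = 1 - x₁ * y₁⁻¹ * y₂⁻¹ * x₂ := by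
    have h : y₂⁻¹ * (x₁ * x₂) * y₁⁻¹ = x₁ * y₁⁻¹ * y₂⁻¹ * x₂ := by
      rw [← mul_assoc, ← cxy.eq, mul_assoc, ← cyx.eq, mul_assoc x₁ y₁⁻¹, cyy'.eq]
      simp only [mul_assoc]
    rw [hP, mul_sub, sub_mul, h, cyy.eq, inv_mul_cancel_left₀ hy₂, mul_inv_cancel₀ hy₁]
  rw [mul_inv_rev, mul_inv_rev, inv_inv, inv_inv, hA, hB, inv_mul_cancel_right₀ hy₂]
  calc P * y₁⁻¹ * (P * y₂⁻¹) - P * y₂⁻¹ * (P * y₁⁻¹)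
      = P * (y₁⁻¹ * P * y₂⁻¹ - y₂⁻¹ * P * y₁⁻¹) := by
        simp only [mul_sub, mul_assoc]
    _ = P * (x₁ * y₁⁻¹ * y₂⁻¹ * x₂ - y₁⁻¹ * x₁ * x₂ * y₂⁻¹) := by
        rw [hBA, hAB, sub_sub_sub_cancel_left]
end

section
/- If in addition x̄₁ and x̄₂ commute, i.e. x̄₁x̄₂ = x̄₂x̄₁, then x₁⁻¹y₁x₁y₁⁻¹ = x₂y₂⁻¹x₂⁻¹y₂. -/
/-- If additionally xb₁ and xb₂ commute, then x₁⁻¹y₁x₁y₁⁻¹ = x₂y₂⁻¹x₂⁻¹y₂. -/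
theorem bar_xx_commute_implies {D : Type*} [DivisionRing D]
    (x₁ y₁ x₂ y₂ : D)
    (hx₁ : x₁ ≠ 0) (hy₁ : y₁ ≠ 0) (hx₂ : x₂ ≠ 0) (hy₂ : y₂ ≠ 0)
    (hxx : x₁ * x₂ = x₂ * x₁) (hyy : y₁ * y₂ = y₂ * y₁)
    (hxy : x₁ * y₂ = y₂ * x₁) (hyx : y₁ * x₂ = x₂ * y₁)
    (h1 : y₁ - x₂ * y₂⁻¹ * x₁ ≠ 0) (h2 : x₁ - y₂ * x₂⁻¹ * y₁ ≠ 0)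
    (h3 : x₂ - y₁ * x₁⁻¹ * y₂ ≠ 0) (h4 : y₂ - x₁ * y₁⁻¹ * x₂ ≠ 0)
    (yb₁ xb₂ xb₁ yb₂ : D)
    (hyb₁ : yb₁ = (y₁ - x₂ * y₂⁻¹ * x₁)⁻¹) (hxb₂ : xb₂ = (x₁ - y₂ * x₂⁻¹ * y₁)⁻¹)
    (hxb₁ : xb₁ = (x₂ - y₁ * x₁⁻¹ * y₂)⁻¹) (hyb₂ : yb₂ = (y₂ - x₁ * y₁⁻¹ * x₂)⁻¹)
    (hbar : xb₁ * xb₂ = xb₂ * xb₁) :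
    x₁⁻¹ * y₁ * x₁ * y₁⁻¹ = x₂ * y₂⁻¹ * x₂⁻¹ * y₂ := by
  have swap : ∀ {a b : D}, a * b = b * a → ∀ w, a * (b * w) = b * (a * w) := fun h w => by
    rw [← mul_assoc, h, mul_assoc]
  have inv_left : ∀ {a b : D}, a * b = b * a → a⁻¹ * b = b * a⁻¹ := fun h =>
    (Commute.inv_left₀ (show Commute _ _ from h)).eq
  have inv_right : ∀ {a b : D}, a * b = b * a → a * b⁻¹ = b⁻¹ * a := fun h =>
    (Commute.inv_right₀ (show Commute _ _ from h)).eq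
  have hyy' := inv_right hyy
  have hxx' := inv_right hxx
  have hxy' := inv_right hxy
  have hyx' := inv_right hyx
  have hAB : (x₁ - y₂ * x₂⁻¹ * y₁) * (x₂ - y₁ * x₁⁻¹ * y₂)
      = (x₂ - y₁ * x₁⁻¹ * y₂) * (x₁ - y₂ * x₂⁻¹ * y₁) := by
    rw [hxb₁, hxb₂, ← mul_inv_rev, ← mul_inv_rev] at hbar
    exact inv_injective hbar
  have factor : (x₁ - y₂ * x₂⁻¹ * y₁) * (y₁⁻¹ * x₁ * y₁ * x₁⁻¹ - x₂ * y₂ * x₂⁻¹ * y₂⁻¹)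
      = -(x₁ * y₁⁻¹ * ((x₁ - y₂ * x₂⁻¹ * y₁) * (x₂ - y₁ * x₁⁻¹ * y₂)
        - (x₂ - y₁ * x₁⁻¹ * y₂) * (x₁ - y₂ * x₂⁻¹ * y₁)) * y₂⁻¹) := by
    simp only [mul_sub, sub_mul, mul_assoc, hxx, hxy, hyx, hxx', hyy', hxy',
      inv_left hxy, inv_left hxy',
      swap hxx, swap hyy, swap hxy, swap hyx, swap hxx', swap hyy', swap hxy', swap hyx',
      swap (inv_left hyy), swap (inv_left hxy), swap (inv_left hyx),
      swap (inv_left hxx'), swap (inv_left hyy'), swap (inv_left hyx'),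
      mul_inv_cancel_left₀ hx₁, mul_inv_cancel_left₀ hy₁, mul_inv_cancel_left₀ hy₂,
      inv_mul_cancel_left₀ hx₂, inv_mul_cancel_left₀ hy₁, inv_mul_cancel₀ hx₁,
      inv_mul_cancel₀ hy₁, mul_one]
    abel
  rw [hAB, sub_self, mul_zero, zero_mul, neg_zero] at factor
  have hz := sub_eq_zero.mp ((mul_eq_zero.mp factor).resolve_left h2)
  obtain ⟨z, hzdef⟩ : ∃ z, z = x₂ * y₂ * x₂⁻¹ * y₂⁻¹ := ⟨_, rfl⟩
  rw [← hzdef] at hz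
  have hz0 : z ≠ 0 := by
    rw [hzdef]
    simp [hx₂, hy₂]
  have comm_x : Commute x₁ z := by
    rw [hzdef]
    exact (((Commute.mul_right hxx hxy).mul_right hxx').mul_right hxy')
  have comm_y : Commute y₂ z := by
    rw [← hz]
    exact ((Commute.mul_right (inv_right hyy.symm) hxy.symm).mul_right hyy.symm).mul_right
      (inv_right hxy.symm)
  have comm_y₁ : Commute y₁ z := by
    rw [hzdef]
    exact (((Commute.mul_right hyx hyy).mul_right hyx').mul_right hyy')
  have e₁ : x₁ * y₁ = z * (y₁ * x₁) := by
    rw [← mul_assoc, ← comm_y₁.eq, ← hz]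
    simp [mul_assoc, hx₁, hy₁]
  have e₂ : x₂ * y₂ = z * (y₂ * x₂) := by
    rw [hzdef]
    simp [mul_assoc, hx₂, hy₂]
  have left : x₁⁻¹ * y₁ * x₁ * y₁⁻¹ = z⁻¹ := by
    have : y₁ * x₁ = x₁ * (z⁻¹ * y₁) := by
      rw [← mul_assoc, comm_x.inv_right₀.eq, mul_assoc, e₁, inv_mul_cancel_left₀ hz0]
    rw [mul_assoc x₁⁻¹, this]
    simp [hx₁, hy₁]
  have right : x₂ * y₂⁻¹ * x₂⁻¹ * y₂ = z⁻¹ := by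
    have : y₂ * x₂ = z⁻¹ * (x₂ * y₂) := by
      rw [e₂, inv_mul_cancel_left₀ hz0]
    have h : x₂ * y₂⁻¹ = y₂⁻¹ * (z⁻¹ * x₂) := by
      apply mul_left_cancel₀ hy₂
      rw [mul_inv_cancel_left₀ hy₂, ← mul_assoc, this]
      simp [mul_assoc, hy₂]
    rw [h, ← mul_assoc, (comm_y.inv_left₀).inv_right₀.eq]
    simp [mul_assoc, hx₂, hy₂]
  rw [left, right]
end

section
/- Assume in addition that x̄₁x̄₂ = x̄₂x̄₁ and ȳ₁ȳ₂ = ȳ₂ȳ₁, and that the element x₁⁻¹y₁x₁y₁⁻¹ is central in D. Then, setting q = x₁⁻¹y₁x₁y₁⁻¹, the element q is nonzero and (x₁, y₁) and (x₂, y₂) form Weyl pairs: y₁x₁ = q·x₁y₁ and y₂x₂ = q·x₂y₂. -/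
/-- If the inverse-matrix entries satisfy the remaining partial commutativity
conditions, and x₁⁻¹y₁x₁y₁⁻¹ is central, then (x₁,y₁) and (x₂,y₂) form Weyl pairs
for q = x₁⁻¹y₁x₁y₁⁻¹. -/
theorem partial_commutativity_implies_weyl {D : Type*} [DivisionRing D]
    (x₁ y₁ x₂ y₂ : D)
    (hx₁ : x₁ ≠ 0) (hy₁ : y₁ ≠ 0) (hx₂ : x₂ ≠ 0) (hy₂ : y₂ ≠ 0)
    (hxx : x₁ * x₂ = x₂ * x₁) (hyy : y₁ * y₂ = y₂ * y₁)
    (hxy : x₁ * y₂ = y₂ * x₁) (hyx : y₁ * x₂ = x₂ * y₁)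
    (h1 : y₁ - x₂ * y₂⁻¹ * x₁ ≠ 0) (h2 : x₁ - y₂ * x₂⁻¹ * y₁ ≠ 0)
    (h3 : x₂ - y₁ * x₁⁻¹ * y₂ ≠ 0) (h4 : y₂ - x₁ * y₁⁻¹ * x₂ ≠ 0)
    (yb₁ xb₂ xb₁ yb₂ : D)
    (hyb₁ : yb₁ = (y₁ - x₂ * y₂⁻¹ * x₁)⁻¹) (hxb₂ : xb₂ = (x₁ - y₂ * x₂⁻¹ * y₁)⁻¹)
    (hxb₁ : xb₁ = (x₂ - y₁ * x₁⁻¹ * y₂)⁻¹) (hyb₂ : yb₂ = (y₂ - x₁ * y₁⁻¹ * x₂)⁻¹)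
    (hbarx : xb₁ * xb₂ = xb₂ * xb₁) (hbary : yb₁ * yb₂ = yb₂ * yb₁)
    (hqcentral : ∀ d : D, (x₁⁻¹ * y₁ * x₁ * y₁⁻¹) * d = d * (x₁⁻¹ * y₁ * x₁ * y₁⁻¹)) :
    x₁⁻¹ * y₁ * x₁ * y₁⁻¹ ≠ 0 ∧
    y₁ * x₁ = (x₁⁻¹ * y₁ * x₁ * y₁⁻¹) * (x₁ * y₁) ∧
    y₂ * x₂ = (x₁⁻¹ * y₁ * x₁ * y₁⁻¹) * (x₂ * y₂) := by
  subst hxb₁ hxb₂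
  have hAB : (x₂ - y₁ * x₁⁻¹ * y₂) * (x₁ - y₂ * x₂⁻¹ * y₁)
      = (x₁ - y₂ * x₂⁻¹ * y₁) * (x₂ - y₁ * x₁⁻¹ * y₂) :=
    ((Commute.inv_left_iff₀).1 ((Commute.inv_right_iff₀).1 hbarx)).eq
  have hq0 : x₁⁻¹ * y₁ * x₁ * y₁⁻¹ ≠ 0 := by simp [hx₁, hy₁]
  have h_weyl : y₁ * x₁ = (x₁⁻¹ * y₁ * x₁ * y₁⁻¹) * (x₁ * y₁) := by
    rw [← mul_assoc, hqcentral]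
    simp [mul_assoc, hx₁, hy₁]
  refine ⟨hq0, h_weyl, ?_⟩
  generalize x₁⁻¹ * y₁ * x₁ * y₁⁻¹ = q at *
  obtain ⟨p, hp⟩ : ∃ p, p = y₁ * x₁⁻¹ := ⟨_, rfl⟩
  obtain ⟨v, hv⟩ : ∃ v, v = y₂ * x₂⁻¹ := ⟨_, rfl⟩
  rw [← hp, ← hv] at hAB
  rw [← hp] at h3
  have hpx₂ : p * x₂ = x₂ * p := by
    rw [hp]; exact (Commute.mul_left hyx (Commute.inv_left₀ hxx)).eq
  have hpy₂ : p * y₂ = y₂ * p := by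
    rw [hp]; exact (Commute.mul_left hyy (Commute.inv_left₀ hxy)).eq
  have hvx₁ : v * x₁ = x₁ * v := by
    rw [hv]; exact (Commute.mul_left (Commute.symm hxy) (Commute.inv_left₀ (Commute.symm hxx))).eq
  have hvy₁ : v * y₁ = y₁ * v := by
    rw [hv]; exact (Commute.mul_left (Commute.symm hyy) (Commute.inv_left₀ (Commute.symm hyx))).eq
  have hpv : p * v = v * p := by
    rw [hv]; exact (Commute.mul_right hpy₂ (Commute.inv_right₀ hpx₂)).eq
  have hpx₁ : p * x₁ = y₁ := by simp [hp, hx₁]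
  have hvx₂ : v * x₂ = y₂ := by simp [hv, hx₂]
  have hx₁p : q * (x₁ * p) = y₁ := by
    apply mul_right_cancel₀ hx₁
    rw [h_weyl, mul_assoc, mul_assoc, hpx₁]
  have hpy₁ : p * y₁ = q * (y₁ * p) := by
    calc p * y₁ = p * (q * (x₁ * p)) := by rw [hx₁p]
      _ = q * (p * x₁ * p) := by rw [← mul_assoc, ← hqcentral]; simp only [mul_assoc]
      _ = q * (y₁ * p) := by rw [hpx₁]
  have hpyx : p * y₂ * x₁ = y₁ * y₂ := by rw [mul_assoc, ← hxy, ← mul_assoc, hpx₁]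
  have hvyx : v * y₁ * x₂ = y₁ * y₂ := by rw [hvy₁, mul_assoc, hvx₂]
  have h_cross : p * y₂ * (v * y₁) - x₂ * (v * y₁) = v * y₁ * (p * y₂) - x₁ * (p * y₂) := by
    simp only [sub_mul, mul_sub, hpyx, hvyx, hxx] at hAB
    have := congrArg (fun t => t - x₂ * x₁ + y₁ * y₂) hAB
    abel_nf at this ⊢
    exact this
  have hq_pyv : q * (p * y₂ * (v * y₁)) = q * (y₂ * v * p) * y₁ := by
    rw [hpy₂, mul_assoc y₂ v p, ← hpv]; simp only [mul_assoc]
  have hq_vyp : q * (v * y₁ * (p * y₂)) = v * y₂ * p * y₁ := by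
    calc q * (v * y₁ * (p * y₂)) = v * (q * (y₁ * p)) * y₂ := by
          simp only [← mul_assoc, hqcentral v]
      _ = v * (p * y₁) * y₂ := by rw [hpy₁]
      _ = v * (p * y₂) * y₁ := by simp only [mul_assoc, hyy]
      _ = v * y₂ * p * y₁ := by rw [hpy₂]; simp only [mul_assoc]
  have hq_xp : q * (x₁ * (p * y₂)) = y₂ * y₁ := by rw [← mul_assoc x₁, ← mul_assoc, hx₁p, hyy]
  have h_cancel : q * (y₂ * v * p) - q * (x₂ * v) = v * y₂ * p - y₂ := by
    apply mul_right_cancel₀ hy₁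
    have := congrArg (fun t => q * t) h_cross
    simp only [mul_sub, hq_pyv, hq_vyp, hq_xp] at this
    simp only [sub_mul, mul_assoc] at this ⊢
    exact this
  have h_factor : (1 - p * v) * (q * (x₂ * y₂) - y₂ * x₂) = 0 := by
    have h := congrArg (fun t => t * x₂) h_cancel
    have h_lead : q * (y₂ * v * p) * x₂ = p * v * (q * (x₂ * y₂)) := by
      calc q * (y₂ * v * p) * x₂ = q * (y₂ * (v * x₂) * p) := by simp only [mul_assoc, hpx₂]
        _ = q * (p * (y₂ * y₂)) := by
          rw [hvx₂, mul_assoc, ← hpy₂, ← mul_assoc y₂, ← hpy₂, mul_assoc]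
        _ = q * (p * ((v * x₂) * y₂)) := by rw [hvx₂]
        _ = q * (p * v) * (x₂ * y₂) := by simp only [mul_assoc]
        _ = p * v * (q * (x₂ * y₂)) := by rw [hqcentral, mul_assoc]
    have h_mid : v * y₂ * p * x₂ = p * v * (y₂ * x₂) := by
      rw [mul_assoc v, ← hpy₂, ← mul_assoc, ← hpv]; simp only [mul_assoc]
    have h_tail : q * (x₂ * v) * x₂ = q * (x₂ * y₂) := by
      rw [mul_assoc, mul_assoc, hvx₂]
    simp only [sub_mul, h_lead, h_mid, h_tail] at h
    rw [sub_mul, one_mul, mul_sub, sub_eq_zero]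
    rw [sub_eq_sub_iff_add_eq_add] at h ⊢
    rw [add_comm, ← h, add_comm]
  rcases mul_eq_zero.1 h_factor with h | h
  · refine absurd ?_ h3
    rw [← hvx₂, ← mul_assoc, ← sub_eq_zero.1 h, one_mul, sub_self]
  · exact (sub_eq_zero.1 h).symm
end

section
/- The bialgebra (A, Δ, ε) admits an antipode, i.e. NSym_n is a Hopf algebra: there exists a k-linear map S : A → A such that for every a ∈ A, μ((S ⊗ id)(Δ(a))) = ε(a)·1 and μ((id ⊗ S)(Δ(a))) = ε(a)·1, where μ : A ⊗[k] A → A is the multiplication map. -/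
open scoped TensorProduct

noncomputable section

/-- Nonempty words (colour sequences) over the alphabet `Fin n`. -/
def ColWord (n : ℕ) : Type := {l : List (Fin n) // l ≠ []}

/-- `NSym_n`: the free associative unital algebra on nonempty words over `Fin n`,
the algebra of `n`-coloured non-commutative symmetric functions. -/
abbrev NSymC (k : Type*) [CommSemiring k] (n : ℕ) : Type _ := FreeAlgebra k (ColWord n)

/-- `[u]`: the generator associated to a word `u`, or `1` if `u` is empty. -/
def wordElem (k : Type*) [CommSemiring k] (n : ℕ) (u : List (Fin n)) : NSymC k n :=
  if h : u = [] then 1 else FreeAlgebra.ι k (⟨u, h⟩ : ColWord n)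

/-- The pruning coproduct on `NSym_n`, sending the generator of a word `w` to the
sum of all deconcatenations of `w` into a prefix and a suffix. -/
def pruningΔ (k : Type*) [CommSemiring k] (n : ℕ) :
    NSymC k n →ₐ[k] NSymC k n ⊗[k] NSymC k n :=
  FreeAlgebra.lift k fun w : ColWord n =>
    ∑ j ∈ Finset.range (w.1.length + 1),
      wordElem k n (w.1.take j) ⊗ₜ[k] wordElem k n (w.1.drop j)

/-- The counit on `NSym_n`, vanishing on all generators. -/
def pruningε (k : Type*) [CommSemiring k] (n : ℕ) : NSymC k n →ₐ[k] k :=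
  FreeAlgebra.lift k fun _ : ColWord n => (0 : k)

section WordConvolution

variable {α R : Type*} [Ring R]

/-- Convolution of functions on words with respect to deconcatenation. -/
def wordConv (f g : List α → R) (w : List α) : R :=
  ∑ j ∈ Finset.range (w.length + 1), f (w.take j) * g (w.drop j)

/-- The unit for `wordConv`: the indicator function of the empty word. -/
def wordConvOne (w : List α) : R := if w = [] then 1 else 0

theorem wordConv_nil (f g : List α → R) : wordConv f g [] = f [] * g [] := by
  simp [wordConv]

theorem wordConv_cons (f g : List α → R) (a : α) (w : List α) :
    wordConv f g (a :: w) = f [] * g (a :: w) + wordConv (fun u => f (a :: u)) g w := by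
  simp [wordConv, List.length_cons, Finset.sum_range_succ' _ (w.length + 1), add_comm (f [] * _)]

theorem wordConv_mul_add (c : R) (f g h : List α → R) (w : List α) :
    wordConv (fun u => c * f u + g u) h w = c * wordConv f h w + wordConv g h w := by
  simp [wordConv, add_mul, Finset.sum_add_distrib, Finset.mul_sum, mul_assoc]

theorem wordConv_assoc (f g h : List α → R) :
    wordConv (wordConv f g) h = wordConv f (wordConv g h) := by
  funext w
  induction w generalizing f with
  | nil => simp [wordConv_nil, mul_assoc]
  | cons a w ih =>
    simp only [wordConv_cons, wordConv_nil, wordConv_mul_add, ih]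
    noncomm_ring

theorem wordConvOne_wordConv (f : List α → R) : wordConv wordConvOne f = f := by
  funext w
  cases w <;> simp [wordConv, wordConvOne]

theorem wordConv_wordConvOne (f : List α → R) : wordConv f wordConvOne = f := by
  funext w
  induction w generalizing f with
  | nil => simp [wordConv_nil, wordConvOne]
  | cons a w ih => simp [wordConv_cons, ih, wordConvOne]

/-- The convolution inverse of a function on words taking the value `1` at the empty word. -/
def wordConvInv (f : List α → R) : List α → R
  | [] => 1
  | a :: w => -∑ j ∈ Finset.range (w.length + 1), f (a :: w.take j) * wordConvInv f (w.drop j)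
termination_by w => w.length
decreasing_by simp

theorem wordConvInv_nil (f : List α → R) : wordConvInv f [] = 1 := by
  simp [wordConvInv]

theorem wordConv_wordConvInv {f : List α → R} (hf : f [] = 1) :
    wordConv f (wordConvInv f) = wordConvOne := by
  funext w
  cases w with
  | nil => simp [wordConv_nil, wordConvInv_nil, wordConvOne, hf]
  | cons a w =>
    rw [wordConv_cons, hf, wordConvInv]
    simp [wordConvOne, wordConv]

theorem wordConvInv_wordConv {f : List α → R} (hf : f [] = 1) :
    wordConv (wordConvInv f) f = wordConvOne := by
  have hinv := wordConv_wordConvInv (wordConvInv_nil f)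
  have hf_eq : wordConvInv (wordConvInv f) = f := by
    rw [← wordConvOne_wordConv (wordConvInv (wordConvInv f)), ← wordConv_wordConvInv hf,
      wordConv_assoc, hinv, wordConv_wordConvOne]
  rwa [hf_eq] at hinv

end WordConvolution

section AntiHom

variable {k A : Type*} [CommRing k] [Ring A] [Algebra k A] {S : A →ₗ[k] A}

theorem mul'_rTensor_mul_tmul (hS : ∀ a b, S (a * b) = S b * S a) (x : A ⊗[k] A) (p q : A) :
    LinearMap.mul' k A (S.rTensor A (x * p ⊗ₜ q)) =
      S p * LinearMap.mul' k A (S.rTensor A x) * q := by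
  induction x with
  | zero => simp
  | tmul a b => simp [hS, mul_assoc]
  | add x y hx hy => simp [add_mul, mul_add, hx, hy]

theorem mul'_lTensor_tmul_mul (hS : ∀ a b, S (a * b) = S b * S a) (p q : A) (y : A ⊗[k] A) :
    LinearMap.mul' k A (S.lTensor A (p ⊗ₜ q * y)) =
      p * LinearMap.mul' k A (S.lTensor A y) * S q := by
  induction y with
  | zero => simp
  | tmul a b => simp [hS, mul_assoc]
  | add x y hx hy => simp [add_mul, mul_add, hx, hy]

theorem mul'_rTensor_mul (hS : ∀ a b, S (a * b) = S b * S a) {x : A ⊗[k] A} {c : k}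
    (hx : LinearMap.mul' k A (S.rTensor A x) = c • 1) (y : A ⊗[k] A) :
    LinearMap.mul' k A (S.rTensor A (x * y)) = c • LinearMap.mul' k A (S.rTensor A y) := by
  induction y with
  | zero => simp
  | tmul a b => simp [mul'_rTensor_mul_tmul hS, hx]
  | add y z hy hz => simp [mul_add, hy, hz]

theorem mul'_lTensor_mul (hS : ∀ a b, S (a * b) = S b * S a) (x : A ⊗[k] A) {y : A ⊗[k] A}
    {c : k} (hy : LinearMap.mul' k A (S.lTensor A y) = c • 1) :
    LinearMap.mul' k A (S.lTensor A (x * y)) = c • LinearMap.mul' k A (S.lTensor A x) := by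
  induction x with
  | zero => simp
  | tmul a b => simp [mul'_lTensor_tmul_mul hS, hy]
  | add x z hx hz => simp [add_mul, hx, hz]

end AntiHom

section Antipode

variable (k : Type*) [Field k] (n : ℕ)

theorem wordElem_nil : wordElem k n [] = 1 := by simp [wordElem]

/-- The antipode of `NSym_n`, as an algebra homomorphism to the opposite algebra. -/
def pruningAntipodeOp : NSymC k n →ₐ[k] (NSymC k n)ᵐᵒᵖ :=
  FreeAlgebra.lift k fun w : ColWord n => MulOpposite.op (wordConvInv (wordElem k n) w.1)

/-- The antipode of `NSym_n`. -/
def pruningAntipode : NSymC k n →ₗ[k] NSymC k n :=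
  (MulOpposite.opLinearEquiv k).symm.toLinearMap ∘ₗ (pruningAntipodeOp k n).toLinearMap

theorem pruningAntipode_one : pruningAntipode k n 1 = 1 := by
  simp [pruningAntipode]

theorem pruningAntipode_mul (a b : NSymC k n) :
    pruningAntipode k n (a * b) = pruningAntipode k n b * pruningAntipode k n a := by
  simp [pruningAntipode]

theorem pruningAntipode_ι (w : ColWord n) :
    pruningAntipode k n (FreeAlgebra.ι k w) = wordConvInv (wordElem k n) w.1 := by
  simp [pruningAntipode, pruningAntipodeOp]

theorem pruningAntipode_wordElem (u : List (Fin n)) :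
    pruningAntipode k n (wordElem k n u) = wordConvInv (wordElem k n) u := by
  by_cases hu : u = []
  · subst hu
    rw [wordElem_nil, pruningAntipode_one, wordConvInv_nil]
  · rw [wordElem, dif_neg hu]
    exact pruningAntipode_ι k n ⟨u, hu⟩

theorem pruningΔ_ι (w : ColWord n) : pruningΔ k n (FreeAlgebra.ι k w) =
    ∑ j ∈ Finset.range (w.1.length + 1),
      wordElem k n (w.1.take j) ⊗ₜ[k] wordElem k n (w.1.drop j) := by
  simp [pruningΔ]

theorem pruningε_ι (w : ColWord n) : pruningε k n (FreeAlgebra.ι k w) = 0 := by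
  simp [pruningε]

theorem mul'_rTensor_pruningAntipode (a : NSymC k n) :
    LinearMap.mul' k (NSymC k n)
      ((pruningAntipode k n).rTensor (NSymC k n) (pruningΔ k n a)) = pruningε k n a • 1 := by
  induction a using FreeAlgebra.induction with
  | grade0 r =>
    simp [Algebra.algebraMap_eq_smul_one, Algebra.TensorProduct.one_def, pruningAntipode_one]
  | grade1 w =>
    have h := congrFun (wordConvInv_wordConv (wordElem_nil k n)) w.1
    simpa [pruningΔ_ι, pruningε_ι, pruningAntipode_wordElem, wordConv, wordConvOne, w.2] using h
  | mul a b ha hb =>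
    rw [map_mul, mul'_rTensor_mul (pruningAntipode_mul k n) ha, hb, map_mul, smul_smul]
  | add a b ha hb => simp only [map_add, ha, hb, add_smul]

theorem mul'_lTensor_pruningAntipode (a : NSymC k n) :
    LinearMap.mul' k (NSymC k n)
      ((pruningAntipode k n).lTensor (NSymC k n) (pruningΔ k n a)) = pruningε k n a • 1 := by
  induction a using FreeAlgebra.induction with
  | grade0 r =>
    simp [Algebra.algebraMap_eq_smul_one, Algebra.TensorProduct.one_def, pruningAntipode_one]
  | grade1 w =>
    have h := congrFun (wordConv_wordConvInv (wordElem_nil k n)) w.1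
    simpa [pruningΔ_ι, pruningε_ι, pruningAntipode_wordElem, wordConv, wordConvOne, w.2] using h
  | mul a b ha hb =>
    rw [map_mul, mul'_lTensor_mul (pruningAntipode_mul k n) _ hb, ha, map_mul, smul_smul, mul_comm]
  | add a b ha hb => simp only [map_add, ha, hb, add_smul]

end Antipode

/-- `NSym_n` admits an antipode, i.e. it is a Hopf algebra. -/
theorem nsym_antipode_exists (k : Type*) [Field k] [CharZero k]
    (n : ℕ) (hn : 1 ≤ n) :
    ∃ S : NSymC k n →ₗ[k] NSymC k n, ∀ a : NSymC k n,
      (LinearMap.mul' k (NSymC k n)) ((LinearMap.rTensor (NSymC k n) S) (pruningΔ k n a)) =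
        pruningε k n a • (1 : NSymC k n) ∧
      (LinearMap.mul' k (NSymC k n)) ((LinearMap.lTensor (NSymC k n) S) (pruningΔ k n a)) =
        pruningε k n a • (1 : NSymC k n) := by
  exact ⟨pruningAntipode k n, fun a =>
    ⟨mul'_rTensor_pruningAntipode k n a, mul'_lTensor_pruningAntipode k n a⟩⟩

end
end

section
/- Let ~ be the smallest monoid congruence on the free monoid on Fin n × ℕ such that (a,i)·(b,j) ~ (b,j)·(a,i) whenever i ≠ j (the Cartier–Foata partial commutativity relations: letters with distinct second index commute). Then two words u and v are congruent under ~ if and only if for every i ∈ ℕ, the subsequence of u consisting of the letters whose second component equals i coincides with the corresponding subsequence of v. -/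
/-- The Cartier–Foata relations on the free monoid on `Fin n × ℕ`: letters whose
second components (levels) differ commute. -/
def CFRel (n : ℕ) : FreeMonoid (Fin n × ℕ) → FreeMonoid (Fin n × ℕ) → Prop :=
  fun u v => ∃ (a b : Fin n) (i j : ℕ), i ≠ j ∧
    u = FreeMonoid.of (a, i) * FreeMonoid.of (b, j) ∧
    v = FreeMonoid.of (b, j) * FreeMonoid.of (a, i)

/-- A letter commutes, modulo the Cartier–Foata relations, past any word containing no letter of
its level. -/
theorem conGen_cfRel_ofList_mul_of {n : ℕ} (x : Fin n × ℕ) (l : List (Fin n × ℕ))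
    (hl : ∀ y ∈ l, y.2 ≠ x.2) :
    conGen (CFRel n) (FreeMonoid.ofList l * FreeMonoid.of x)
      (FreeMonoid.of x * FreeMonoid.ofList l) := by
  induction l with
  | nil => exact (conGen (CFRel n)).refl _
  | cons y l ih =>
    rw [List.forall_mem_cons] at hl
    have hyx : conGen (CFRel n) (FreeMonoid.of y * FreeMonoid.of x)
        (FreeMonoid.of x * FreeMonoid.of y) :=
      ConGen.Rel.of _ _ ⟨y.1, x.1, y.2, x.2, hl.1, rfl, rfl⟩
    have h₁ := (conGen (CFRel n)).mul ((conGen (CFRel n)).refl (FreeMonoid.of y)) (ih hl.2)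
    have h₂ := (conGen (CFRel n)).mul hyx ((conGen (CFRel n)).refl (FreeMonoid.ofList l))
    rw [FreeMonoid.ofList_cons]
    simp only [mul_assoc] at h₁ h₂ ⊢
    exact h₁.trans h₂

/-- Congruent words have the same subsequence at each level. -/
theorem filter_level_eq_of_conGen_cfRel {n : ℕ} {u v : FreeMonoid (Fin n × ℕ)}
    (h : conGen (CFRel n) u v) (i : ℕ) :
    (FreeMonoid.toList u).filter (fun p => p.2 = i) =
      (FreeMonoid.toList v).filter (fun p => p.2 = i) := by
  replace h : ConGen.Rel (CFRel n) u v := h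
  induction h with
  | of _ _ h =>
    obtain ⟨a, b, j, k, hjk, rfl, rfl⟩ := h
    simp only [FreeMonoid.toList_mul, FreeMonoid.toList_of, List.filter_append,
      List.filter_singleton]
    grind
  | refl => rfl
  | symm _ ih => exact ih.symm
  | trans _ _ ih₁ ih₂ => exact ih₁.trans ih₂
  | mul _ _ ih₁ ih₂ =>
    rw [FreeMonoid.toList_mul, FreeMonoid.toList_mul, List.filter_append, List.filter_append,
      ih₁, ih₂]

/-- Words with the same subsequence at each level are congruent. -/
theorem conGen_cfRel_ofList_of_filter_level_eq {n : ℕ} (u v : List (Fin n × ℕ))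
    (h : ∀ i : ℕ, u.filter (fun p => p.2 = i) = v.filter (fun p => p.2 = i)) :
    conGen (CFRel n) (FreeMonoid.ofList u) (FreeMonoid.ofList v) := by
  induction u generalizing v with
  | nil =>
    have hv : v = [] := List.eq_nil_iff_forall_not_mem.2 fun y hy => by
      have hy' : y ∈ v.filter (fun p => p.2 = y.2) := List.mem_filter.2 ⟨hy, decide_eq_true rfl⟩
      rw [← h y.2] at hy'
      exact List.not_mem_nil hy'
    rw [hv]
    exact (conGen (CFRel n)).refl _
  | cons x u ih =>
    have hx := (h x.2).symm
    rw [List.filter_cons_of_pos (by simp), List.filter_eq_cons_iff] at hx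
    obtain ⟨l₁, l₂, rfl, hl₁, -, -⟩ := hx
    have hl₁ : ∀ y ∈ l₁, y.2 ≠ x.2 := by simpa using hl₁
    have hu : conGen (CFRel n) (FreeMonoid.ofList u) (FreeMonoid.ofList (l₁ ++ l₂)) := by
      refine ih _ fun i => ?_
      have hi := h i
      by_cases hxi : x.2 = i
      · subst hxi
        have hnil : l₁.filter (fun p => p.2 = x.2) = [] := by simpa using hl₁
        simpa [List.filter_append, hnil] using hi
      · simpa [List.filter_append, List.filter_cons, hxi] using hi
    have h₁ := (conGen (CFRel n)).mul ((conGen (CFRel n)).refl (FreeMonoid.of x)) hu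
    have h₂ := (conGen (CFRel n)).mul (conGen_cfRel_ofList_mul_of x l₁ hl₁)
      ((conGen (CFRel n)).refl (FreeMonoid.ofList l₂))
    simp only [FreeMonoid.ofList_append, FreeMonoid.ofList_cons, mul_assoc] at h₁ h₂ ⊢
    exact h₁.trans h₂.symm

/-- Two words are congruent modulo the Cartier–Foata partial commutativity
relations iff for each level `i` the subsequences of letters at level `i` agree. -/
theorem cf_congruence_iff_level_subsequences (n : ℕ)
    (u v : FreeMonoid (Fin n × ℕ)) :
    conGen (CFRel n) u v ↔
      ∀ i : ℕ, (FreeMonoid.toList u).filter (fun p => p.2 = i) =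
        (FreeMonoid.toList v).filter (fun p => p.2 = i) :=
  ⟨filter_level_eq_of_conGen_cfRel,
    conGen_cfRel_ofList_of_filter_level_eq (FreeMonoid.toList u) (FreeMonoid.toList v)⟩
end

section
/- The quasi-shuffle product ⧢ on Q is associative and the empty multisequence ∅ is a two-sided unit for it; hence Q, which has the multisequences as a k-basis, is an associative unital k-algebra (the algebra QSym_n of n-coloured quasi-symmetric functions in its monomial basis). -/
open scoped TensorProduct

noncomputable section

/-- Nonempty words over `Fin n`. -/
abbrev CWord (n : ℕ) : Type := {l : List (Fin n) // l ≠ []}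

/-- Multisequences: finite lists of nonempty words over `Fin n`. -/
abbrev Multiseq (n : ℕ) : Type := List (CWord n)

/-- `QSym_n` in its monomial basis: the free `k`-module on multisequences. -/
abbrev QSymC (k : Type*) [Field k] (n : ℕ) : Type _ := Multiseq n →₀ k

/-- Concatenation of two nonempty words. -/
def wordConcat {n : ℕ} (I J : CWord n) : CWord n := ⟨I.1 ++ J.1, by simp [I.2]⟩

/-- The quasi-shuffle product of two basis multisequences. -/
def qsBasis (k : Type*) [Field k] (n : ℕ) : Multiseq n → Multiseq n → QSymC k n
  | [], J => Finsupp.single J 1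
  | I :: Is, [] => Finsupp.single (I :: Is) 1
  | I :: Is, J :: Js =>
      Finsupp.mapDomain (fun L => I :: L) (qsBasis k n Is (J :: Js)) +
      Finsupp.mapDomain (fun L => J :: L) (qsBasis k n (I :: Is) Js) +
      Finsupp.mapDomain (fun L => wordConcat I J :: L) (qsBasis k n Is Js)
  termination_by I J => I.length + J.length

/-- The quasi-shuffle product on `QSym_n`, the bilinear extension of `qsBasis`. -/
def qmulL (k : Type*) [Field k] (n : ℕ) :
    QSymC k n →ₗ[k] QSymC k n →ₗ[k] QSymC k n :=
  Finsupp.lift (QSymC k n →ₗ[k] QSymC k n) k (Multiseq n) fun I =>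
    Finsupp.lift (QSymC k n) k (Multiseq n) fun J => qsBasis k n I J

/-- Prepending the block `I` to every multisequence, as a linear map. -/
def qcons (k : Type*) [Field k] {n : ℕ} (I : CWord n) : QSymC k n →ₗ[k] QSymC k n :=
  Finsupp.lmapDomain k k fun L => I :: L

theorem qcons_single {k : Type*} [Field k] {n : ℕ} (I : CWord n) (L : Multiseq n) (a : k) :
    qcons k I (Finsupp.single L a) = Finsupp.single (I :: L) a := by
  simp [qcons]

theorem qmulL_single_single {k : Type*} [Field k] {n : ℕ} (I J : Multiseq n) :
    qmulL k n (Finsupp.single I 1) (Finsupp.single J 1) = qsBasis k n I J := by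
  simp [qmulL]

theorem nil_qmulL {k : Type*} [Field k] {n : ℕ} (u : QSymC k n) :
    qmulL k n (Finsupp.single [] 1) u = u := by
  suffices h : qmulL k n (Finsupp.single [] 1) = LinearMap.id from DFunLike.congr_fun h u
  refine Finsupp.lhom_ext' fun J => LinearMap.ext_ring ?_
  simp [qmulL_single_single, qsBasis]

theorem qmulL_nil {k : Type*} [Field k] {n : ℕ} (u : QSymC k n) :
    qmulL k n u (Finsupp.single [] 1) = u := by
  suffices h : (qmulL k n).flip (Finsupp.single [] 1) = LinearMap.id from DFunLike.congr_fun h u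
  refine Finsupp.lhom_ext' fun J => LinearMap.ext_ring ?_
  cases J <;> simp [qmulL_single_single, qsBasis]

/-- The defining recursion of the quasi-shuffle product, extended bilinearly. -/
theorem qcons_qmulL_qcons {k : Type*} [Field k] {n : ℕ} (I J : CWord n) (u v : QSymC k n) :
    qmulL k n (qcons k I u) (qcons k J v) =
      qcons k I (qmulL k n u (qcons k J v)) + qcons k J (qmulL k n (qcons k I u) v) +
        qcons k (wordConcat I J) (qmulL k n u v) := by
  suffices h : (qmulL k n).compl₁₂ (qcons k I) (qcons k J) =
      ((qmulL k n).compl₂ (qcons k J)).compr₂ (qcons k I) +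
        ((qmulL k n).comp (qcons k I)).compr₂ (qcons k J) +
        (qmulL k n).compr₂ (qcons k (wordConcat I J)) from
    LinearMap.congr_fun₂ h u v
  refine Finsupp.lhom_ext' fun Is => LinearMap.ext_ring <|
    Finsupp.lhom_ext' fun Js => LinearMap.ext_ring ?_
  simp only [LinearMap.comp_apply, LinearMap.add_apply, LinearMap.compl₁₂_apply,
    LinearMap.compl₂_apply, LinearMap.compr₂_apply, Finsupp.lsingle_apply, qcons_single,
    qmulL_single_single]
  rw [qsBasis]
  rfl

theorem wordConcat_assoc {n : ℕ} (I J K : CWord n) :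
    wordConcat (wordConcat I J) K = wordConcat I (wordConcat J K) :=
  Subtype.ext (List.append_assoc _ _ _)

theorem qmulL_assoc_single {k : Type*} [Field k] {n : ℕ} : ∀ I J K : Multiseq n,
    qmulL k n (qmulL k n (Finsupp.single I 1) (Finsupp.single J 1)) (Finsupp.single K 1) =
      qmulL k n (Finsupp.single I 1) (qmulL k n (Finsupp.single J 1) (Finsupp.single K 1))
  | [], _, _ => by simp only [nil_qmulL]
  | _ :: _, [], _ => by simp only [nil_qmulL, qmulL_nil]
  | _ :: _, _ :: _, [] => by simp only [qmulL_nil]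
  | I :: Is, J :: Js, K :: Ks => by
    have h₁ := qmulL_assoc_single (k := k) Is (J :: Js) (K :: Ks)
    have h₂ := qmulL_assoc_single (k := k) (I :: Is) Js (K :: Ks)
    have h₃ := qmulL_assoc_single (k := k) (I :: Is) (J :: Js) Ks
    have h₄ := qmulL_assoc_single (k := k) Is Js (K :: Ks)
    have h₅ := qmulL_assoc_single (k := k) Is (J :: Js) Ks
    have h₆ := qmulL_assoc_single (k := k) (I :: Is) Js Ks
    have h₇ := qmulL_assoc_single (k := k) Is Js Ks
    simp only [← qcons_single] at *
    simp only [qcons_qmulL_qcons, map_add, LinearMap.add_apply, wordConcat_assoc] at *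
    simp only [h₁, h₂, h₄, h₅, h₆, h₇]
    have h := congrArg (qcons k K) h₃
    simp only [map_add] at h
    grind
  termination_by I J K => I.length + J.length + K.length

theorem qmulL_assoc {k : Type*} [Field k] {n : ℕ} (u v w : QSymC k n) :
    qmulL k n (qmulL k n u v) w = qmulL k n u (qmulL k n v w) := by
  induction u using Finsupp.induction_linear with
  | zero => simp
  | add u₁ u₂ h₁ h₂ => simp only [map_add, LinearMap.add_apply, h₁, h₂]
  | single I a =>
  induction v using Finsupp.induction_linear with
  | zero => simp
  | add v₁ v₂ h₁ h₂ => simp only [map_add, LinearMap.add_apply, h₁, h₂]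
  | single J b =>
  induction w using Finsupp.induction_linear with
  | zero => simp
  | add w₁ w₂ h₁ h₂ => simp only [map_add, h₁, h₂]
  | single K c =>
  rw [← Finsupp.smul_single_one I a, ← Finsupp.smul_single_one J b,
    ← Finsupp.smul_single_one K c]
  simp only [map_smul, LinearMap.smul_apply, qmulL_assoc_single]

/-- The quasi-shuffle product is associative with the empty multisequence as
two-sided unit, so `QSym_n` is an associative unital `k`-algebra. -/
theorem qshuffle_assoc_unital (k : Type*) [Field k] [CharZero k]
    (n : ℕ) (hn : 1 ≤ n) :
    (∀ u v w : QSymC k n,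
        qmulL k n (qmulL k n u v) w = qmulL k n u (qmulL k n v w)) ∧
    (∀ u : QSymC k n,
        qmulL k n (Finsupp.single ([] : Multiseq n) 1) u = u ∧
        qmulL k n u (Finsupp.single ([] : Multiseq n) 1) = u) := by
  exact ⟨qmulL_assoc, fun u => ⟨nil_qmulL u, qmulL_nil u⟩⟩

end
end

section
/- For every m ≥ 0, the m-th complete homogeneous symmetric polynomial in the disjoint union of two sets of variables splits as h_m(X, Y) = Σ_{i=0}^{m} h_i(X) · h_{m−i}(Y); precisely, in MvPolynomial (σ ⊕ τ) R one has hsymm m = Σ_{i=0}^{m} rename Sum.inl (hsymm i) * rename Sum.inr (hsymm (m−i)). (This is the variables-doubling identity underlying the coproduct formula Δ(h_m) = Σ_i h_i ⊗ h_{m−i} in the Hopf algebra of symmetric functions.) -/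
open MvPolynomial

namespace Multiset

variable {α β : Type*}

theorem map_inl_add_map_inr_filterMap (u : Multiset (α ⊕ β)) :
    (u.filterMap Sum.getLeft?).map Sum.inl + (u.filterMap Sum.getRight?).map Sum.inr = u := by
  induction u using Multiset.induction_on with
  | empty => simp
  | cons a u ih =>
    cases a with
    | inl a =>
      rw [filterMap_cons_some _ _ _ Sum.getLeft?_inl, filterMap_cons_none _ _ rfl, map_cons,
        cons_add, ih]
    | inr b =>
      rw [filterMap_cons_none _ _ rfl, filterMap_cons_some _ _ _ Sum.getRight?_inr, map_cons,
        add_cons, ih]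

theorem filterMap_getLeft?_map_inl_add_map_inr (s : Multiset α) (t : Multiset β) :
    (s.map Sum.inl + t.map Sum.inr).filterMap Sum.getLeft? = s := by
  induction s using Multiset.induction_on with
  | empty =>
    induction t using Multiset.induction_on with
    | empty => simp
    | cons b t ih =>
      rw [map_cons, add_cons, filterMap_cons_none _ _ rfl, ih]
  | cons a s ih =>
    rw [map_cons, cons_add, filterMap_cons_some _ _ _ Sum.getLeft?_inl, ih]

end Multiset

/-- The union of a multiset of size `i` on `α` and one of size `m - i` on `β`, as a multiset of
size `m` on `α ⊕ β`. -/
def Sym.sumUnion {α β : Type*} {m : ℕ} (x : Σ i : Fin (m + 1), Sym α i × Sym β (m - i)) :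
    Sym (α ⊕ β) m :=
  ⟨x.2.1.1.map Sum.inl + x.2.2.1.map Sum.inr, by
    rw [Multiset.card_add, Multiset.card_map, Multiset.card_map, x.2.1.2, x.2.2.2]
    exact Nat.add_sub_of_le (Nat.le_of_lt_succ x.1.2)⟩

theorem Sym.sumUnion_bijective {α β : Type*} {m : ℕ} :
    Function.Bijective (Sym.sumUnion (α := α) (β := β) (m := m)) := by
  constructor
  · rintro ⟨i, s, t⟩ ⟨j, s', t'⟩ h
    have h' : s.1.map Sum.inl + t.1.map Sum.inr = s'.1.map Sum.inl + t'.1.map Sum.inr :=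
      congrArg Subtype.val h
    have hs : s.1 = s'.1 := by
      simpa only [Multiset.filterMap_getLeft?_map_inl_add_map_inr] using
        congrArg (Multiset.filterMap Sum.getLeft?) h'
    obtain rfl : i = j := Fin.ext (s.2.symm.trans ((congrArg Multiset.card hs).trans s'.2))
    rw [hs] at h'
    have ht : t.1 = t'.1 := Multiset.map_injective Sum.inr_injective (add_left_cancel h')
    rw [Subtype.ext hs, Subtype.ext ht]
  · intro u
    have h := Multiset.map_inl_add_map_inr_filterMap u.1
    have hc := congrArg Multiset.card h
    rw [Multiset.card_add, Multiset.card_map, Multiset.card_map, u.2] at hc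
    exact ⟨⟨⟨(u.1.filterMap Sum.getLeft?).card, by omega⟩, ⟨u.1.filterMap Sum.getLeft?, rfl⟩,
      ⟨u.1.filterMap Sum.getRight?, by dsimp only; omega⟩⟩, Subtype.ext h⟩

/-- Variables-doubling identity for complete homogeneous symmetric polynomials:
`h_m(X, Y) = ∑_{i=0}^{m} h_i(X) * h_{m-i}(Y)` in `MvPolynomial (σ ⊕ τ) R`. -/
theorem hsymm_sum_split (R : Type*) [CommRing R]
    (σ τ : Type*) [Fintype σ] [Fintype τ] [DecidableEq σ] [DecidableEq τ] (m : ℕ) :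
    hsymm (σ ⊕ τ) R m =
      ∑ i ∈ Finset.range (m + 1),
        rename (Sum.inl : σ → σ ⊕ τ) (hsymm σ R i) *
          rename (Sum.inr : τ → σ ⊕ τ) (hsymm τ R (m - i)) := by
  simp only [hsymm, map_sum, Finset.sum_mul_sum, ← Fintype.sum_prod_type']
  rw [Finset.sum_range, ← Fintype.sum_sigma', ← Sym.sumUnion_bijective.sum_comp]
  refine Fintype.sum_congr _ _ fun x => ?_
  simp [Sym.sumUnion, map_multiset_prod, Multiset.map_map]
end
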